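/- Let 1 < α < 2 and E, A ∈ ℝ^{n×n}. The triplet (E, A, α) is admissible if and only if there exists a matrix P ∈ ℝ^{n×n} such that Sym{Θ⊗(PA)} is negative definite and PE = EᵀPᵀ is positive semidefinite, where Θ = [[sin(απ/2), −cos(απ/2)], [cos(απ/2), sin(απ/2)]]. -/

import Mathlib

open Matrix Kronecker

/-- The reindexing equivalence for a block splitting `n = r + s`. -/
def blockEquiv {n r s : ℕ} (h : n = r + s) : Fin r ⊕ Fin s ≃ Fin n :=
  finSumFinEquiv.trans (finCongr h.symm)

/-- `Sym M = M + Mᵀ`. -/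
def matSym {m : Type*} (M : Matrix m m ℝ) : Matrix m m ℝ := M + Mᵀ

/-- A real matrix is negative definite iff its negation is positive definite. -/
def NegDef {m : Type*} [Fintype m] (M : Matrix m m ℝ) : Prop := (-M).PosDef

/-- The pencil `(E, A)` is regular and impulse-free: for some `r`, invertible `M, N` give
`M E N = diag(I_r, 0)` and `M A N = diag(A₁, I_{n-r})`. -/
def RegularImpulseFree {n : ℕ} (E A : Matrix (Fin n) (Fin n) ℝ) : Prop :=
  ∃ (r s : ℕ) (h : n = r + s) (M N : Matrix (Fin n) (Fin n) ℝ)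
    (A₁ : Matrix (Fin r) (Fin r) ℝ),
    IsUnit M ∧ IsUnit N ∧
    (M * E * N).submatrix (blockEquiv h) (blockEquiv h) = Matrix.fromBlocks 1 0 0 0 ∧
    (M * A * N).submatrix (blockEquiv h) (blockEquiv h) = Matrix.fromBlocks A₁ 0 0 1

/-- The triplet `(E, A, α)` is admissible: regular, impulse-free, and every finite
eigenvalue `λ` of the pencil satisfies `|arg λ| > απ/2`. -/
def Admissible {n : ℕ} (E A : Matrix (Fin n) (Fin n) ℝ) (α : ℝ) : Prop :=
  RegularImpulseFree E A ∧
  ∀ lam : ℂ, (lam • E.map Complex.ofReal - A.map Complex.ofReal).det = 0 →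
    α * Real.pi / 2 < |lam.arg|

/-- The matrix `Θ = [[sin(απ/2), −cos(απ/2)], [cos(απ/2), sin(απ/2)]]`. -/
noncomputable def Θmat (α : ℝ) : Matrix (Fin 2) (Fin 2) ℝ :=
  !![Real.sin (α * Real.pi / 2), -Real.cos (α * Real.pi / 2);
     Real.cos (α * Real.pi / 2),  Real.sin (α * Real.pi / 2)]

theorem exists_basis_approx_diagonal {δ : ℝ} (hδ : 0 < δ) (r : ℕ) :
    ∀ {V : Type*} [AddCommGroup V] [Module ℂ V] [FiniteDimensional ℂ V] (f : Module.End ℂ V),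
      Module.finrank ℂ V = r →
      ∃ (b : Module.Basis (Fin r) ℂ V) (μ : Fin r → ℂ), (∀ i, f.HasEigenvalue (μ i)) ∧
        ∀ i j, ‖b.repr (f (b j) - μ j • b j) i‖ ≤ δ := by
  induction r with
  | zero =>
    intro V _ _ _ f hV
    exact ⟨Module.finBasisOfFinrankEq ℂ V hV, Fin.elim0, fun i => i.elim0, fun i => i.elim0⟩
  | succ r ih =>
    intro V _ _ _ f hV
    have : Nontrivial V := Module.nontrivial_of_finrank_pos (R := ℂ) (by omega)
    obtain ⟨lam, hlam⟩ := Module.End.exists_eigenvalue f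
    have hrange : LinearMap.range (f - algebraMap ℂ (Module.End ℂ V) lam) < ⊤ := by
      rw [lt_top_iff_ne_top, Ne, ← LinearMap.ker_eq_bot_iff_range_eq_top,
        Algebra.algebraMap_eq_smul_one, ← Module.End.eigenspace_def]
      exact hlam
    obtain ⟨φ, hφ0, hφ⟩ := Submodule.exists_le_ker_of_lt_top _ hrange
    have hsub : ∀ x, f x - lam • x ∈ LinearMap.ker φ := fun x => hφ ⟨x, by simp⟩
    have hinv : ∀ x ∈ LinearMap.ker φ, f x ∈ LinearMap.ker φ := fun x hx => by
      simpa using add_mem (hsub x) (Submodule.smul_mem _ lam hx)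
    obtain ⟨u, hu⟩ : ∃ u, φ u = 1 := LinearMap.surjective hφ0 1
    obtain ⟨b', μ, hμ, hb'⟩ := ih (f.restrict hinv)
      (by have := Module.Dual.finrank_ker_add_one_of_ne_zero hφ0; omega)
    set h₀ : LinearMap.ker φ := ⟨f u - lam • u, hsub u⟩ with hh₀
    set t : ℝ := δ / (1 + ∑ j, ‖b'.repr h₀ j‖) with ht
    have hS : 0 < 1 + ∑ j, ‖b'.repr h₀ j‖ := by positivity
    have ht0 : 0 < t := by positivity
    have htC : (t : ℂ) ≠ 0 := by exact_mod_cast ht0.ne'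
    let b : Module.Basis (Fin (r + 1)) ℂ V := Module.Basis.mkFinCons ((t : ℂ) • u) b'
      (fun c x hx h => by
        have := congrArg φ h
        simpa [hu, LinearMap.mem_ker.1 hx, htC] using this)
      (fun z => ⟨-(φ z / t), by simp [hu, htC]⟩)
    have hb0 : b 0 = (t : ℂ) • u := by simp [b]
    have hbs : ∀ j, b (Fin.succ j) = b' j := fun j => by simp [b]
    have key : ∀ h : LinearMap.ker φ, b.repr h 0 = 0 ∧ ∀ j, b.repr h (Fin.succ j) = b'.repr h j := by
      intro h
      have hsum : (h : V) = ∑ i, (Fin.cons 0 (b'.repr h) : Fin (r + 1) → ℂ) i • b i := by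
        have := congrArg (LinearMap.ker φ).subtype (b'.sum_repr h)
        simp only [map_sum, map_smul, Submodule.subtype_apply] at this
        simp [Fin.sum_univ_succ, hbs, this]
      have : ∀ i, b.repr h i = (Fin.cons 0 (b'.repr h) : Fin (r + 1) → ℂ) i := by
        intro i
        rw [hsum, b.repr_sum_self]
      exact ⟨by simp [this], fun j => by simp [this]⟩
    refine ⟨b, Fin.cons lam μ, ?_, ?_⟩
    · refine Fin.cases (by simpa using hlam) fun i => ?_
      obtain ⟨v, hv⟩ := (hμ i).exists_hasEigenvector
      refine Module.End.hasEigenvalue_of_hasEigenvector (x := (v : V)) ⟨?_, ?_⟩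
      · have := congrArg Subtype.val hv.apply_eq_smul
        simpa [Module.End.mem_eigenspace_iff] using this
      · simpa using hv.2
    · intro i j
      refine Fin.cases ?_ (fun j => ?_) j
      · have h1 : f (b 0) - (Fin.cons lam μ : Fin (r + 1) → ℂ) 0 • b 0
            = (((t : ℂ) • h₀ : LinearMap.ker φ) : V) := by
          simp only [hb0, hh₀, map_smul, Fin.cons_zero, Submodule.coe_smul, smul_sub,
            smul_comm lam (t : ℂ) u]
        rw [h1]
        refine Fin.cases ?_ (fun i => ?_) i
        · simp only [(key _).1, norm_zero, hδ.le]
        · rw [(key _).2]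
          have : ‖b'.repr h₀ i‖ ≤ ∑ j, ‖b'.repr h₀ j‖ :=
            Finset.single_le_sum (f := fun j => ‖b'.repr h₀ j‖) (fun _ _ => norm_nonneg _)
              (Finset.mem_univ i)
          simp only [map_smul, Finsupp.smul_apply, smul_eq_mul, norm_mul, Complex.norm_real,
            Real.norm_eq_abs, abs_of_pos ht0]
          rw [ht, div_mul_eq_mul_div, div_le_iff₀ hS]
          nlinarith
      · have h1 : f (b j.succ) - (Fin.cons lam μ : Fin (r + 1) → ℂ) j.succ • b j.succ
            = ((f.restrict hinv (b' j) - μ j • b' j : LinearMap.ker φ) : V) := by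
          simp [hbs]
        rw [h1]
        refine Fin.cases ?_ (fun i => ?_) i
        · simp only [(key _).1, norm_zero, hδ.le]
        · rw [(key _).2]
          exact hb' i j

theorem lt_abs_arg_iff {θ : ℝ} (h₁ : Real.pi / 2 < θ) (h₂ : θ < Real.pi) (z : ℂ) :
    θ < |z.arg| ↔ Real.sin θ * z.re + |Real.cos θ * z.im| < 0 := by
  have hcos : Real.cos θ < 0 := Real.cos_neg_of_pi_div_two_lt_of_lt h₁ (by linarith)
  rcases eq_or_ne z 0 with rfl | hz
  · simp; linarith [Real.pi_pos]
  have habs : |z.arg| ≤ Real.pi := Complex.abs_arg_le_pi z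
  have hsin : |Real.sin z.arg| = Real.sin |z.arg| := Real.abs_sin_eq_sin_abs_of_abs_le_pi habs
  have key : Real.sin θ * z.re + |Real.cos θ * z.im| = ‖z‖ * Real.sin (θ - |z.arg|) := by
    rw [← Complex.norm_mul_cos_arg z, ← Complex.norm_mul_sin_arg z, abs_mul, abs_mul, hsin,
      abs_of_neg hcos, abs_of_nonneg (norm_nonneg z), Real.sin_sub, Real.cos_abs]
    ring
  rw [key, mul_neg_iff]
  have hn : 0 < ‖z‖ := norm_pos_iff.2 hz
  constructor
  · intro h
    exact Or.inl ⟨hn, Real.sin_neg_of_neg_of_neg_pi_lt (by linarith) (by linarith)⟩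
  · rintro (⟨-, h⟩ | ⟨h, -⟩)
    · by_contra! hc
      linarith [Real.sin_nonneg_of_nonneg_of_le_pi (sub_nonneg.2 hc)
        (by linarith [abs_nonneg z.arg])]
    · linarith

/-- The function `z ↦ s Re z + |c Im z|`, negative exactly on a sector about the negative axis. -/
noncomputable def sectorGauge (s c : ℝ) (z : ℂ) : ℝ := s * z.re + |c * z.im|

section SectorGauge

variable (s c : ℝ)

theorem sectorGauge_add_le (z w : ℂ) :
    sectorGauge s c (z + w) ≤ sectorGauge s c z + sectorGauge s c w := by
  have := abs_add_le (c * z.im) (c * w.im)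
  simp only [sectorGauge, Complex.add_re, Complex.add_im, mul_add]
  linarith

theorem sectorGauge_sum_le {ι : Type*} (t : Finset ι) (z : ι → ℂ) :
    sectorGauge s c (∑ i ∈ t, z i) ≤ ∑ i ∈ t, sectorGauge s c (z i) :=
  Finset.le_sum_of_subadditive _ (by simp [sectorGauge]) (sectorGauge_add_le s c) t z

theorem sectorGauge_ofReal_mul {a : ℝ} (ha : 0 ≤ a) (z : ℂ) :
    sectorGauge s c (a * z) = a * sectorGauge s c z := by
  have : c * (a * z.im) = a * (c * z.im) := by ring
  simp only [sectorGauge, Complex.re_ofReal_mul, Complex.im_ofReal_mul, this, abs_mul a,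
    abs_of_nonneg ha]
  ring

theorem sectorGauge_star (z : ℂ) : sectorGauge s c (star z) = sectorGauge s c z := by
  simp [sectorGauge]

theorem sectorGauge_le_norm (z : ℂ) : sectorGauge s c z ≤ (|s| + |c|) * ‖z‖ := by
  have h₁ : s * z.re ≤ |s| * ‖z‖ := (le_abs_self _).trans (by
    rw [abs_mul]; exact mul_le_mul_of_nonneg_left (Complex.abs_re_le_norm z) (abs_nonneg s))
  have h₂ : |c * z.im| ≤ |c| * ‖z‖ := by
    rw [abs_mul]; exact mul_le_mul_of_nonneg_left (Complex.abs_im_le_norm z) (abs_nonneg c)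
  simp only [sectorGauge]
  linarith

theorem exists_isUnit_sectorGauge_neg {r : ℕ} (A : Matrix (Fin r) (Fin r) ℂ)
    (hA : ∀ μ : ℂ, (μ • 1 - A).det = 0 → sectorGauge s c μ < 0) :
    ∃ U : Matrix (Fin r) (Fin r) ℂ, IsUnit U ∧
      ∀ z ≠ 0, sectorGauge s c (star (U *ᵥ z) ⬝ᵥ U *ᵥ A *ᵥ z) < 0 := by
  set f : Module.End ℂ (Fin r → ℂ) := Matrix.toLin' A with hf
  have heig : ∀ μ, f.HasEigenvalue μ → sectorGauge s c μ < 0 := by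
    intro μ hμ
    obtain ⟨v, hv⟩ := hμ.exists_hasEigenvector
    refine hA μ (Matrix.exists_mulVec_eq_zero_iff.1 ⟨v, hv.2, ?_⟩)
    have := hv.apply_eq_smul
    rw [hf, Matrix.toLin'_apply] at this
    rw [Matrix.sub_mulVec, Matrix.smul_mulVec, Matrix.one_mulVec, this, sub_self]
  obtain ⟨κ, hκ, hκle⟩ : ∃ κ > 0, ∀ μ, f.HasEigenvalue μ → sectorGauge s c μ ≤ -κ := by
    have hfin : {μ | f.HasEigenvalue μ}.Finite := Module.End.finite_hasEigenvalue f
    rcases {μ | f.HasEigenvalue μ}.eq_empty_or_nonempty with he | hne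
    · exact ⟨1, one_pos, fun μ hμ => absurd hμ (Set.eq_empty_iff_forall_notMem.1 he μ)⟩
    · obtain ⟨μ₀, h₀, hmax⟩ := Set.exists_max_image _ (sectorGauge s c) hfin hne
      exact ⟨-sectorGauge s c μ₀, neg_pos.2 (heig _ h₀), fun μ hμ => by
        simpa using hmax μ hμ⟩
  set K : ℝ := (|s| + |c|) * r with hK
  have hK0 : 0 ≤ K := by positivity
  obtain ⟨b, μ, hμ, hb⟩ := exists_basis_approx_diagonal (δ := κ / (K + 1)) (by positivity) r f
    (by simp)
  have hU : ∀ z, LinearMap.toMatrix' b.equivFun.toLinearMap *ᵥ z = b.equivFun z := fun z => by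
    simp [LinearMap.toMatrix'_mulVec]
  refine ⟨LinearMap.toMatrix' b.equivFun.toLinearMap, ?_, fun z hz => ?_⟩
  · rw [Matrix.isUnit_iff_isUnit_det, isUnit_iff_ne_zero, Ne, ← Matrix.exists_mulVec_eq_zero_iff]
    rintro ⟨v, hv, h⟩
    rw [hU] at h
    exact hv ((LinearEquiv.map_eq_zero_iff _).1 h)
  rw [hU, hU, ← Matrix.toLin'_apply A z, ← hf]
  set y := b.equivFun z with hy
  have hy0 : y ≠ 0 := fun h => hz ((LinearEquiv.map_eq_zero_iff _).1 h)
  set R : Fin r → Fin r → ℂ := fun i j => b.repr (f (b j) - μ j • b j) i with hR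
  have hfz : ∀ i, b.equivFun (f z) i = μ i * y i + ∑ j, R i j * y j := by
    intro i
    have h1 : z = ∑ j, y j • b j := (b.sum_equivFun z).symm
    have h2 : f z = ∑ j, y j • (μ j • b j) + ∑ j, y j • (f (b j) - μ j • b j) := by
      conv_lhs => rw [h1]
      simp only [map_sum, map_smul, smul_sub, Finset.sum_sub_distrib, add_sub_cancel]
    rw [h2]
    simp [hR, Finsupp.single_apply, mul_comm]
  have hexp : star y ⬝ᵥ b.equivFun (f z)
      = ∑ i, ((‖y i‖ ^ 2 : ℝ) : ℂ) * μ i + ∑ i, ∑ j, star (y i) * R i j * y j := by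
    simp only [dotProduct, hfz, mul_add, Finset.sum_add_distrib, Finset.mul_sum, Pi.star_apply]
    congr 1
    · refine Finset.sum_congr rfl fun i _ => ?_
      have : star (y i) * y i = ((‖y i‖ ^ 2 : ℝ) : ℂ) := by
        rw [Complex.star_def, Complex.conj_mul']; push_cast; rfl
      rw [← this]; ring
    · simp only [mul_assoc]
  set S : ℝ := ∑ i, ‖y i‖ ^ 2 with hS
  have hS0 : 0 < S := by
    obtain ⟨i, hi⟩ := Function.ne_iff.1 hy0
    exact Finset.sum_pos' (fun _ _ => by positivity) ⟨i, Finset.mem_univ i,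
      pow_pos (norm_pos_iff.2 hi) 2⟩
  have hdiag : sectorGauge s c (∑ i, ((‖y i‖ ^ 2 : ℝ) : ℂ) * μ i) ≤ -κ * S := by
    refine (sectorGauge_sum_le s c _ _).trans ?_
    rw [hS, Finset.mul_sum]
    refine Finset.sum_le_sum fun i _ => ?_
    rw [sectorGauge_ofReal_mul s c (by positivity)]
    nlinarith [hκle _ (hμ i), sq_nonneg ‖y i‖]
  have hrem : ‖∑ i, ∑ j, star (y i) * R i j * y j‖ ≤ κ / (K + 1) * (r * S) := by
    calc ‖∑ i, ∑ j, star (y i) * R i j * y j‖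
        ≤ ∑ i, ∑ j, ‖star (y i) * R i j * y j‖ :=
          (norm_sum_le _ _).trans (Finset.sum_le_sum fun i _ => norm_sum_le _ _)
      _ ≤ ∑ i, ∑ j, κ / (K + 1) * (‖y i‖ * ‖y j‖) := by
          refine Finset.sum_le_sum fun i _ => Finset.sum_le_sum fun j _ => ?_
          rw [norm_mul, norm_mul, norm_star]
          nlinarith [mul_le_mul_of_nonneg_right (hb i j)
            (mul_nonneg (norm_nonneg (y i)) (norm_nonneg (y j)))]
      _ = κ / (K + 1) * (∑ i, ‖y i‖) ^ 2 := by
          rw [sq, Finset.sum_mul_sum, Finset.mul_sum]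
          simp only [Finset.mul_sum]
      _ ≤ κ / (K + 1) * (r * S) := by
          refine mul_le_mul_of_nonneg_left ?_ (by positivity)
          simpa using sq_sum_le_card_mul_sum_sq (s := Finset.univ) (f := fun i => ‖y i‖)
  rw [hexp]
  have h1 := sectorGauge_add_le s c (∑ i, ((‖y i‖ ^ 2 : ℝ) : ℂ) * μ i)
    (∑ i, ∑ j, star (y i) * R i j * y j)
  have h2 := sectorGauge_le_norm s c (∑ i, ∑ j, star (y i) * R i j * y j)
  have h3 := mul_le_mul_of_nonneg_left hrem (by positivity : 0 ≤ |s| + |c|)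
  have h4 : (|s| + |c|) * (κ / (K + 1) * (r * S)) = κ * S - κ / (K + 1) * S := by
    have hK1 : K + 1 ≠ 0 := by positivity
    have : κ / (K + 1) * (K + 1) = κ := div_mul_cancel₀ _ hK1
    calc (|s| + |c|) * (κ / (K + 1) * (r * S)) = κ / (K + 1) * K * S := by rw [hK]; ring
      _ = (κ / (K + 1) * (K + 1)) * S - κ / (K + 1) * S := by ring
      _ = _ := by rw [this]
  have h5 : 0 < κ / (K + 1) * S := by positivity
  linarith

end SectorGauge

/-- The Hermitian-type form `z* X z` of a real matrix `X` on complex vectors. -/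
noncomputable def complexForm {m : Type*} [Fintype m] (X : Matrix m m ℝ) (z : m → ℂ) : ℂ :=
  star z ⬝ᵥ X.map Complex.ofReal *ᵥ z

theorem map_ofReal_mul {l m n : Type*} [Fintype m] (X : Matrix l m ℝ) (Y : Matrix m n ℝ) :
    (X * Y).map Complex.ofReal = X.map Complex.ofReal * Y.map Complex.ofReal :=
  Matrix.map_mul (f := Complex.ofRealHom)

open scoped ComplexOrder in
theorem exists_posDef_sectorGauge_neg (s c : ℝ) {r : ℕ} (A : Matrix (Fin r) (Fin r) ℝ)
    (hA : ∀ μ : ℂ, (μ • 1 - A.map Complex.ofReal).det = 0 → sectorGauge s c μ < 0) :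
    ∃ P : Matrix (Fin r) (Fin r) ℝ, P.PosDef ∧
      ∀ z ≠ 0, sectorGauge s c (complexForm (P * A) z) < 0 := by
  obtain ⟨U, hU, hneg⟩ := exists_isUnit_sectorGauge_neg s c _ hA
  set W := Uᴴ * U with hW
  have hWpos : W.PosDef := Matrix.PosDef.conjTranspose_mul_self U
    (Matrix.mulVec_injective_iff_isUnit.2 hU)
  have hP : (W.map Complex.re).map Complex.ofReal = (1 / 2 : ℂ) • (W + W.map star) := by
    ext i j
    simp only [Matrix.map_apply, Matrix.smul_apply, Matrix.add_apply, smul_eq_mul,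
      Complex.re_eq_add_conj, Complex.star_def]
    ring
  have hform : ∀ v w : Fin r → ℂ, star v ⬝ᵥ W.map star *ᵥ w
      = star (star (star v) ⬝ᵥ W *ᵥ star w) := by
    intro v w
    rw [Matrix.star_dotProduct, star_star]
    simp [dotProduct, Matrix.mulVec, mul_comm]
  refine ⟨W.map Complex.re, .of_dotProduct_mulVec_pos ?_ fun x hx => ?_, fun z hz => ?_⟩
  · ext i j
    have := congrArg Complex.re (hWpos.isHermitian.apply i j)
    simpa using this
  · have hx' : (fun i => (x i : ℂ)) ≠ 0 := fun h => hx (by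
      ext i; simpa using congrFun h i)
    have := (Complex.lt_def.1 (hWpos.dotProduct_mulVec_pos hx')).1
    simpa [dotProduct, Matrix.mulVec, Finset.mul_sum] using this
  · have hstarA : star (A.map Complex.ofReal *ᵥ z) = A.map Complex.ofReal *ᵥ star z := by
      ext i
      simp [Matrix.mulVec, dotProduct]
    have hWU : ∀ v, star v ⬝ᵥ W *ᵥ A.map Complex.ofReal *ᵥ v
        = star (U *ᵥ v) ⬝ᵥ U *ᵥ A.map Complex.ofReal *ᵥ v := by
      intro v
      rw [hW, ← Matrix.mulVec_mulVec, Matrix.dotProduct_mulVec, ← Matrix.star_mulVec]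
    have : complexForm (W.map Complex.re * A) z = ((1 / 2 : ℝ) : ℂ) *
        (star (U *ᵥ z) ⬝ᵥ U *ᵥ A.map Complex.ofReal *ᵥ z
          + star (star (U *ᵥ star z) ⬝ᵥ U *ᵥ A.map Complex.ofReal *ᵥ star z)) := by
      rw [complexForm, map_ofReal_mul, hP, ← Matrix.mulVec_mulVec, Matrix.smul_mulVec, Matrix.add_mulVec,
        dotProduct_smul, dotProduct_add, hform, hstarA, hWU, hWU]
      simp
    rw [this, sectorGauge_ofReal_mul s c (by norm_num)]
    have h1 := sectorGauge_add_le s c (star (U *ᵥ z) ⬝ᵥ U *ᵥ A.map Complex.ofReal *ᵥ z)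
      (star (star (U *ᵥ star z) ⬝ᵥ U *ᵥ A.map Complex.ofReal *ᵥ star z))
    rw [sectorGauge_star] at h1
    have h2 := hneg z hz
    have h3 := hneg (star z) (by simpa using hz)
    linarith

theorem complexForm_re {m : Type*} [Fintype m] (X : Matrix m m ℝ) (x y : m → ℝ) :
    (complexForm X fun i => ⟨x i, y i⟩).re = x ⬝ᵥ X *ᵥ x + y ⬝ᵥ X *ᵥ y := by
  simp [complexForm, dotProduct, Matrix.mulVec, Finset.sum_add_distrib]

theorem complexForm_im {m : Type*} [Fintype m] (X : Matrix m m ℝ) (x y : m → ℝ) :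
    (complexForm X fun i => ⟨x i, y i⟩).im = x ⬝ᵥ X *ᵥ y - y ⬝ᵥ X *ᵥ x := by
  simp [complexForm, dotProduct, Matrix.mulVec, Finset.sum_add_distrib, sub_eq_add_neg]

theorem dotProduct_rotation_kronecker_mulVec {m : Type*} [Fintype m] (s c : ℝ)
    (X : Matrix m m ℝ) (v : Fin 2 × m → ℝ) :
    v ⬝ᵥ (!![s, -c; c, s] ⊗ₖ X) *ᵥ v
      = s * (complexForm X fun i => ⟨v (0, i), v (1, i)⟩).re
        - c * (complexForm X fun i => ⟨v (0, i), v (1, i)⟩).im := by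
  rw [complexForm_re, complexForm_im]
  simp only [dotProduct, Matrix.mulVec, Fintype.sum_prod_type, Fin.sum_univ_two,
    Matrix.kroneckerMap_apply, Matrix.of_apply, Matrix.cons_val', Matrix.cons_val_zero,
    Matrix.cons_val_one, Matrix.cons_val_fin_one, Finset.mul_sum, mul_add, mul_sub,
    ← Finset.sum_add_distrib, ← Finset.sum_sub_distrib]
  refine Finset.sum_congr rfl fun i _ => Finset.sum_congr rfl fun j _ => ?_
  ring

theorem negDef_matSym_iff {m : Type*} [Fintype m] (M : Matrix m m ℝ) :
    NegDef (matSym M) ↔ ∀ v ≠ 0, v ⬝ᵥ M *ᵥ v < 0 := by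
  have hv : ∀ v, v ⬝ᵥ (-(matSym M)) *ᵥ v = -(2 * (v ⬝ᵥ M *ᵥ v)) := by
    intro v
    have : v ⬝ᵥ Mᵀ *ᵥ v = v ⬝ᵥ M *ᵥ v := by
      rw [Matrix.mulVec_transpose, dotProduct_comm, ← Matrix.dotProduct_mulVec]
    rw [Matrix.neg_mulVec, dotProduct_neg, matSym, Matrix.add_mulVec, dotProduct_add, this]
    ring
  rw [NegDef, Matrix.posDef_iff_dotProduct_mulVec]
  constructor
  · rintro ⟨-, h⟩ v hv0
    have := h hv0
    rw [star_trivial, hv] at this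
    linarith
  · refine fun h => ⟨?_, fun v hv0 => ?_⟩
    · simp [matSym, Matrix.IsHermitian, Matrix.conjTranspose_eq_transpose_of_trivial, add_comm]
    · rw [star_trivial, hv]
      linarith [h v hv0]

theorem negDef_matSym_rotation_kronecker_iff {m : Type*} [Fintype m] (s c : ℝ)
    (X : Matrix m m ℝ) :
    NegDef (matSym (!![s, -c; c, s] ⊗ₖ X)) ↔
      ∀ z ≠ 0, sectorGauge s c (complexForm X z) < 0 := by
  rw [negDef_matSym_iff]
  constructor
  · intro h z hz
    have aux : ∀ x y : m → ℝ, (∀ i, x i = 0 ∧ y i = 0 → z i = 0) →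
        s * (complexForm X fun i => ⟨x i, y i⟩).re
          - c * (complexForm X fun i => ⟨x i, y i⟩).im < 0 := by
      intro x y hxy
      have := h (fun p => if p.1 = 0 then x p.2 else y p.2) fun h0 => hz (funext fun i =>
        hxy i ⟨by simpa using congrFun h0 (0, i), by simpa using congrFun h0 (1, i)⟩)
      rw [dotProduct_rotation_kronecker_mulVec] at this
      simpa using this
    have h1 := aux (fun i => (z i).re) (fun i => (z i).im) fun i hi => Complex.ext hi.1 hi.2
    have h2 := aux (fun i => (z i).im) (fun i => (z i).re) fun i hi => Complex.ext hi.2 hi.1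
    have hre := complexForm_re X (fun i => (z i).re) (fun i => (z i).im)
    have him := complexForm_im X (fun i => (z i).re) (fun i => (z i).im)
    rw [complexForm_re, complexForm_im] at h1 h2
    simp only [Complex.eta] at hre him
    rw [sectorGauge, hre, him]
    rcases abs_cases (c * ((fun i => (z i).re) ⬝ᵥ X *ᵥ (fun i => (z i).im)
      - (fun i => (z i).im) ⬝ᵥ X *ᵥ (fun i => (z i).re))) with ⟨h, -⟩ | ⟨h, -⟩ <;>
    rw [h] <;> linarith
  · intro h v hv
    rw [dotProduct_rotation_kronecker_mulVec]
    have := h (fun i => ⟨v (0, i), v (1, i)⟩) fun h0 => hv (by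
      ext ⟨k, i⟩
      have := Complex.ext_iff.1 (congrFun h0 i)
      fin_cases k
      · exact this.1
      · exact this.2)
    rw [sectorGauge] at this
    linarith [neg_abs_le (c * (complexForm X fun i => ⟨v (0, i), v (1, i)⟩).im)]

theorem complexForm_congruence {l m : Type*} [Fintype l] [Fintype m] (X : Matrix m m ℝ)
    (N : Matrix m l ℝ) (z : l → ℂ) :
    complexForm (Nᵀ * X * N) z = complexForm X (N.map Complex.ofReal *ᵥ z) := by
  have : (Nᵀ).map Complex.ofReal = (N.map Complex.ofReal)ᴴ := by
    ext i j; simp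
  rw [complexForm, complexForm, map_ofReal_mul, map_ofReal_mul, this, Matrix.mul_assoc,
    ← Matrix.mulVec_mulVec, ← Matrix.mulVec_mulVec, Matrix.dotProduct_mulVec, ← Matrix.star_mulVec]

theorem map_ofReal_isUnit {m : Type*} [Fintype m] [DecidableEq m] {N : Matrix m m ℝ}
    (hN : IsUnit N) : IsUnit (N.map Complex.ofReal) :=
  hN.map (Complex.ofRealHom.mapMatrix (m := m))

theorem sectorGauge_complexForm_congruence {l m : Type*} [Fintype l] [Fintype m] {s c : ℝ}
    {X : Matrix m m ℝ} (hX : ∀ z ≠ 0, sectorGauge s c (complexForm X z) < 0) {N : Matrix m l ℝ}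
    (hN : Function.Injective (N.map Complex.ofReal *ᵥ ·)) :
    ∀ z ≠ 0, sectorGauge s c (complexForm (Nᵀ * X * N) z) < 0 := by
  intro z hz
  rw [complexForm_congruence]
  exact hX _ fun h => hz (hN (by simpa using h))

theorem isUnit_of_sectorGauge_neg {m : Type*} [Fintype m] [DecidableEq m] {s c : ℝ}
    {X : Matrix m m ℝ} (hX : ∀ z ≠ 0, sectorGauge s c (complexForm X z) < 0) : IsUnit X := by
  rw [Matrix.isUnit_iff_isUnit_det, isUnit_iff_ne_zero, Ne, ← Matrix.exists_mulVec_eq_zero_iff]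
  rintro ⟨x, hx, h⟩
  have := hX (fun i => ⟨x i, 0⟩) fun h0 => hx (funext fun i =>
    (Complex.ext_iff.1 (congrFun h0 i)).1)
  have h1 := complexForm_re X x 0
  have h2 := complexForm_im X x 0
  simp only [Pi.zero_apply] at h1 h2
  rw [sectorGauge, h1, h2, h] at this
  simp at this

theorem exists_congruence_fromBlocks_one_zero {n : ℕ} {Q : Matrix (Fin n) (Fin n) ℝ}
    (hQ : Q.PosSemidef) :
    ∃ (r s : ℕ) (h : n = r + s) (N : Matrix (Fin n) (Fin n) ℝ), IsUnit N ∧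
      (Nᵀ * Q * N).submatrix (blockEquiv h) (blockEquiv h) = Matrix.fromBlocks 1 0 0 0 := by
  have hH := hQ.isHermitian
  set d : Fin n → ℝ := hH.eigenvalues with hd
  set U : Matrix (Fin n) (Fin n) ℝ := hH.eigenvectorUnitary.1 with hU
  have hUU : Uᵀ * U = 1 := by
    have := Unitary.coe_star_mul_self hH.eigenvectorUnitary
    rwa [Matrix.star_eq_conjTranspose, Matrix.conjTranspose_eq_transpose_of_trivial] at this
  have hQU : Q = U * diagonal d * Uᵀ := by
    have := hH.spectral_theorem
    rw [Unitary.conjStarAlgAut_apply] at this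
    rw [this, Matrix.star_eq_conjTranspose, Matrix.conjTranspose_eq_transpose_of_trivial]
    rfl
  set r := Fintype.card {i // d i ≠ 0}
  set s := Fintype.card {i // ¬ d i ≠ 0}
  have h : n = r + s := by
    have := Fintype.card_subtype_compl (fun i => d i ≠ 0)
    have := Fintype.card_subtype_le (fun i => d i ≠ 0)
    simp only [Fintype.card_fin] at *
    omega
  let e : Fin r ⊕ Fin s ≃ Fin n :=
    ((Fintype.equivFin {i // d i ≠ 0}).symm.sumCongr
      (Fintype.equivFin {i // ¬ d i ≠ 0}).symm).trans (Equiv.sumCompl _)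
  have he₁ : ∀ i, d (e (Sum.inl i)) ≠ 0 := fun i => by
    simpa [e] using ((Fintype.equivFin {i // d i ≠ 0}).symm i).2
  have he₂ : ∀ i, d (e (Sum.inr i)) = 0 := fun i => by
    simpa [e] using ((Fintype.equivFin {i // ¬ d i ≠ 0}).symm i).2
  set t : Fin n → ℝ := fun i => if d i = 0 then 1 else (√(d i))⁻¹ with ht
  have ht0 : ∀ i, t i ≠ 0 := fun i => by
    by_cases hi : d i = 0
    · simp [ht, hi]
    · have := (Real.sqrt_pos.2 ((hQ.eigenvalues_nonneg i).lt_of_ne' hi)).ne'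
      simpa [ht, hi] using this
  have htd : ∀ i, t i * d i * t i = if d i = 0 then 0 else 1 := fun i => by
    by_cases hi : d i = 0
    · simp [hi]
    · have h0 := (Real.sqrt_pos.2 ((hQ.eigenvalues_nonneg i).lt_of_ne' hi)).ne'
      have h1 := Real.mul_self_sqrt (hQ.eigenvalues_nonneg i)
      change √(d i) ≠ 0 at h0
      change √(d i) * √(d i) = d i at h1
      simp only [ht, hi, if_false]
      field_simp
      rw [sq, h1]
  set σ : Fin n ≃ Fin n := (blockEquiv h).symm.trans e with hσ
  have hDiag : (U * diagonal t)ᵀ * Q * (U * diagonal t)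
      = diagonal fun i => if d i = 0 then 0 else 1 := by
    rw [hQU, Matrix.transpose_mul, Matrix.diagonal_transpose]
    calc diagonal t * Uᵀ * (U * diagonal d * Uᵀ) * (U * diagonal t)
        = diagonal t * (Uᵀ * U) * diagonal d * (Uᵀ * U) * diagonal t := by
          simp only [Matrix.mul_assoc]
      _ = _ := by
          rw [hUU, Matrix.mul_one, Matrix.mul_one, Matrix.diagonal_mul_diagonal,
            Matrix.diagonal_mul_diagonal]
          simp only [htd]
  refine ⟨r, s, h, (U * diagonal t).submatrix id σ, ?_, ?_⟩
  · have hunit : IsUnit (U * diagonal t) := by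
      refine (IsUnit.of_mul_eq_one_right _ hUU).mul ?_
      rw [Matrix.isUnit_diagonal, Pi.isUnit_iff]
      exact fun i => isUnit_iff_ne_zero.2 (ht0 i)
    exact (Matrix.isUnit_submatrix_equiv (e₁ := Equiv.refl _) (e₂ := σ)).2 hunit
  · have : ((U * diagonal t).submatrix id σ)ᵀ * Q * (U * diagonal t).submatrix id σ
        = ((U * diagonal t)ᵀ * Q * (U * diagonal t)).submatrix σ σ := by
      ext i j
      simp [Matrix.mul_apply]
    rw [this, hDiag, Matrix.submatrix_submatrix]
    have hσe : σ ∘ blockEquiv h = e := by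
      ext i
      simp [hσ]
    rw [hσe]
    ext (i | i) (j | j)
    · simp [Matrix.diagonal_apply, Matrix.one_apply, he₁]
    · simp
    · simp
    · simp [Matrix.diagonal_apply, he₂]

theorem complexForm_submatrix_symm {l m : Type*} [Fintype l] [Fintype m] (X : Matrix l l ℝ)
    (e : l ≃ m) (z : m → ℂ) :
    complexForm (X.submatrix e.symm e.symm) z = complexForm X (z ∘ e) := by
  simp only [complexForm, dotProduct, Matrix.mulVec]
  rw [← e.sum_comp]
  refine Finset.sum_congr rfl fun i _ => ?_
  rw [← e.sum_comp]
  simp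

theorem complexForm_fromBlocks_diagonal {l m : Type*} [Fintype l] [Fintype m]
    (X : Matrix l l ℝ) (Y : Matrix m m ℝ) (z : l ⊕ m → ℂ) :
    complexForm (Matrix.fromBlocks X 0 0 Y) z
      = complexForm X (z ∘ Sum.inl) + complexForm Y (z ∘ Sum.inr) := by
  simp [complexForm, dotProduct, Matrix.mulVec]

theorem sectorGauge_complexForm_neg_one {m : Type*} [Fintype m] [DecidableEq m] {s : ℝ} (c : ℝ)
    (hs : 0 < s) : ∀ z ≠ 0, sectorGauge s c (complexForm (-1 : Matrix m m ℝ) z) < 0 := by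
  intro z hz
  have h : complexForm (-1 : Matrix m m ℝ) z = ((∑ i, ‖z i‖ ^ 2 : ℝ) : ℂ) * (-1) := by
    have hmap : (-1 : Matrix m m ℝ).map Complex.ofReal = -1 := by
      ext i j; by_cases hij : i = j <;> simp [hij]
    rw [complexForm, hmap, Matrix.neg_mulVec, Matrix.one_mulVec, dotProduct_neg]
    simp [dotProduct, Complex.conj_mul']
  have hpos : 0 < ∑ i, ‖z i‖ ^ 2 := by
    obtain ⟨i, hi⟩ := Function.ne_iff.1 hz
    exact Finset.sum_pos' (fun _ _ => by positivity) ⟨i, Finset.mem_univ i,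
      pow_pos (norm_pos_iff.2 hi) 2⟩
  rw [h, sectorGauge_ofReal_mul s c hpos.le]
  have : sectorGauge s c (-1) = -s := by simp [sectorGauge]
  rw [this]
  nlinarith

theorem sectorGauge_complexForm_fromBlocks {l m : Type*} [Fintype l] [Fintype m] {s c : ℝ}
    {X : Matrix l l ℝ} {Y : Matrix m m ℝ}
    (hX : ∀ z ≠ 0, sectorGauge s c (complexForm X z) < 0)
    (hY : ∀ z ≠ 0, sectorGauge s c (complexForm Y z) < 0) :
    ∀ z ≠ 0, sectorGauge s c (complexForm (Matrix.fromBlocks X 0 0 Y) z) < 0 := by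
  intro z hz
  rw [complexForm_fromBlocks_diagonal]
  refine (sectorGauge_add_le s c _ _).trans_lt ?_
  have hX' : sectorGauge s c (complexForm X (z ∘ Sum.inl)) ≤ 0 := by
    rcases eq_or_ne (z ∘ Sum.inl) 0 with h | h
    · simp [h, complexForm, sectorGauge]
    · exact (hX _ h).le
  by_cases hr : z ∘ Sum.inr = 0
  · have hl : z ∘ Sum.inl ≠ 0 := fun hl => hz (by
      ext (i | i)
      · exact congrFun hl i
      · exact congrFun hr i)
    have : sectorGauge s c (complexForm Y (z ∘ Sum.inr)) = 0 := by
      simp [hr, complexForm, sectorGauge]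
    linarith [hX _ hl]
  · linarith [hY _ hr]

theorem injective_map_ofReal_mulVec {m : Type*} [Fintype m] [DecidableEq m] {N : Matrix m m ℝ}
    (hN : IsUnit N) : Function.Injective (N.map Complex.ofReal *ᵥ ·) :=
  Matrix.mulVec_injective_iff_isUnit.2 (map_ofReal_isUnit hN)

theorem posSemidef_fromBlocks_zero {l m : Type*} [Fintype l] [Fintype m]
    {X : Matrix l l ℝ} (hX : X.PosSemidef) :
    (Matrix.fromBlocks X 0 0 (0 : Matrix m m ℝ)).PosSemidef := by
  refine .of_dotProduct_mulVec_nonneg ?_ fun z => ?_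
  · rw [Matrix.isHermitian_fromBlocks_iff]
    exact ⟨hX.isHermitian, by simp, by simp, Matrix.isHermitian_zero⟩
  · have := hX.dotProduct_mulVec_nonneg (z ∘ Sum.inl)
    simpa [dotProduct, Matrix.mulVec] using this

theorem det_smul_sub_eq_zero_of_block {n r s : ℕ} (h : n = r + s)
    {E A M N : Matrix (Fin n) (Fin n) ℝ} {A₁ : Matrix (Fin r) (Fin r) ℝ}
    (hM : IsUnit M) (hN : IsUnit N)
    (hE : (M * E * N).submatrix (blockEquiv h) (blockEquiv h) = Matrix.fromBlocks 1 0 0 0)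
    (hA : (M * A * N).submatrix (blockEquiv h) (blockEquiv h) = Matrix.fromBlocks A₁ 0 0 1)
    {μ : ℂ} (hμ : (μ • 1 - A₁.map Complex.ofReal).det = 0) :
    (μ • E.map Complex.ofReal - A.map Complex.ofReal).det = 0 := by
  have hblock : (M.map Complex.ofReal * (μ • E.map Complex.ofReal - A.map Complex.ofReal)
      * N.map Complex.ofReal).submatrix (blockEquiv h) (blockEquiv h)
      = Matrix.fromBlocks (μ • 1 - A₁.map Complex.ofReal) 0 0 (-1) := by
    have h1 : M.map Complex.ofReal * (μ • E.map Complex.ofReal - A.map Complex.ofReal)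
        * N.map Complex.ofReal
        = μ • (M * E * N).map Complex.ofReal - (M * A * N).map Complex.ofReal := by
      simp only [map_ofReal_mul, Matrix.mul_sub, Matrix.sub_mul, Matrix.mul_smul, Matrix.smul_mul]
    rw [h1, Matrix.submatrix_sub, Matrix.submatrix_smul]
    simp only [Pi.sub_apply, Pi.smul_apply, Matrix.submatrix_map, hE, hA]
    ext (i | i) (j | j)
    · by_cases hij : i = j <;> simp [hij]
    · simp
    · simp
    · by_cases hij : i = j <;> simp [hij]
  have hdet := congrArg Matrix.det hblock
  rw [Matrix.det_submatrix_equiv_self, Matrix.det_fromBlocks_zero₂₁, hμ, zero_mul,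
    Matrix.det_mul, Matrix.det_mul] at hdet
  have hM' := ((Matrix.isUnit_iff_isUnit_det _).1 (map_ofReal_isUnit hM)).ne_zero
  have hN' := ((Matrix.isUnit_iff_isUnit_det _).1 (map_ofReal_isUnit hN)).ne_zero
  simpa [hM', hN'] using hdet

theorem regularImpulseFree_of_sectorGauge_neg {n : ℕ} {s c : ℝ}
    {E A P : Matrix (Fin n) (Fin n) ℝ} (hE : (P * E).PosSemidef)
    (hA : ∀ z ≠ 0, sectorGauge s c (complexForm (P * A) z) < 0) : RegularImpulseFree E A := by
  obtain ⟨r, q, h, N, hN, hNE⟩ := exists_congruence_fromBlocks_one_zero hE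
  set e := blockEquiv h with he
  have hY := sectorGauge_complexForm_congruence hA (injective_map_ofReal_mulVec hN)
  set Y := (Nᵀ * (P * A) * N).submatrix e e with hYdef
  have hYe : Y.submatrix e.symm e.symm = Nᵀ * (P * A) * N := by
    simp [hYdef]
  have hY22 : ∀ z ≠ 0, sectorGauge s c (complexForm Y.toBlocks₂₂ z) < 0 := by
    intro z hz
    have h0 : (Sum.elim 0 z : Fin r ⊕ Fin q → ℂ) ∘ e.symm ≠ 0 := fun h0 => hz (by
      ext i
      simpa using congrFun h0 (e (Sum.inr i)))
    have := hY _ h0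
    rw [← hYe, complexForm_submatrix_symm] at this
    have hc : ((Sum.elim 0 z : Fin r ⊕ Fin q → ℂ) ∘ e.symm) ∘ e = Sum.elim (0 : Fin r → ℂ) z := by
      ext i; simp
    rw [hc] at this
    have hf : complexForm Y (Sum.elim (0 : Fin r → ℂ) z) = complexForm Y.toBlocks₂₂ z := by
      simp [complexForm, dotProduct, Matrix.mulVec, Matrix.toBlocks₂₂]
    rwa [hf] at this
  have hU22 := isUnit_of_sectorGauge_neg hY22
  have hdet22 := (Matrix.isUnit_iff_isUnit_det _).1 hU22
  have hPA := isUnit_of_sectorGauge_neg hA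
  have hP : IsUnit P := by
    rw [Matrix.isUnit_iff_isUnit_det, Matrix.det_mul] at hPA
    exact (Matrix.isUnit_iff_isUnit_det _).2 (isUnit_of_mul_isUnit_left hPA)
  set L : Matrix (Fin r ⊕ Fin q) (Fin r ⊕ Fin q) ℝ :=
    Matrix.fromBlocks 1 (-(Y.toBlocks₁₂ * Y.toBlocks₂₂⁻¹)) 0 Y.toBlocks₂₂⁻¹ with hL
  set R : Matrix (Fin r ⊕ Fin q) (Fin r ⊕ Fin q) ℝ :=
    Matrix.fromBlocks 1 0 (-(Y.toBlocks₂₂⁻¹ * Y.toBlocks₂₁)) 1 with hR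
  have hLu : IsUnit (L.submatrix e.symm e.symm) := by
    rw [Matrix.isUnit_submatrix_equiv, Matrix.isUnit_iff_isUnit_det, hL,
      Matrix.det_fromBlocks_zero₂₁, Matrix.det_one, one_mul]
    exact Matrix.isUnit_nonsing_inv_det _ hdet22
  have hRu : IsUnit (R.submatrix e.symm e.symm) := by
    rw [Matrix.isUnit_submatrix_equiv, Matrix.isUnit_iff_isUnit_det, hR,
      Matrix.det_fromBlocks_zero₁₂]
    simp
  have hNt : IsUnit Nᵀ := by
    rwa [Matrix.isUnit_transpose]
  have hconj : ∀ X : Matrix (Fin n) (Fin n) ℝ,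
      (L.submatrix e.symm e.symm * (Nᵀ * P) * X * (N * R.submatrix e.symm e.symm)).submatrix e e
        = L * (Nᵀ * (P * X) * N).submatrix e e * R := by
    intro X
    have : L.submatrix e.symm e.symm * (Nᵀ * P) * X * (N * R.submatrix e.symm e.symm)
        = L.submatrix e.symm e.symm * (Nᵀ * (P * X) * N) * R.submatrix e.symm e.symm := by
      simp only [Matrix.mul_assoc]
    rw [this, Matrix.submatrix_mul _ _ e e e e.bijective,
      Matrix.submatrix_mul _ _ e e e e.bijective]
    simp
  refine ⟨r, q, h, L.submatrix e.symm e.symm * (Nᵀ * P), N * R.submatrix e.symm e.symm,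
    Y.toBlocks₁₁ - Y.toBlocks₁₂ * Y.toBlocks₂₂⁻¹ * Y.toBlocks₂₁, hLu.mul (hNt.mul hP),
    hN.mul hRu, ?_, ?_⟩
  · rw [hconj, hNE, hL, hR, Matrix.fromBlocks_multiply, Matrix.fromBlocks_multiply]
    simp
  · rw [hconj, ← hYdef, ← Matrix.fromBlocks_toBlocks Y, hL, hR]
    simp only [Matrix.toBlocks_fromBlocks₁₁, Matrix.toBlocks_fromBlocks₁₂,
      Matrix.toBlocks_fromBlocks₂₁, Matrix.toBlocks_fromBlocks₂₂]
    rw [Matrix.fromBlocks_multiply, Matrix.fromBlocks_multiply]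
    have h1 : Y.toBlocks₂₂⁻¹ * Y.toBlocks₂₂ = 1 := Matrix.nonsing_inv_mul _ hdet22
    have h2 : Y.toBlocks₁₂ * Y.toBlocks₂₂⁻¹ * Y.toBlocks₂₂ = Y.toBlocks₁₂ := by
      rw [Matrix.mul_assoc, h1, Matrix.mul_one]
    simp [h1, h2, sub_eq_add_neg]

theorem sectorGauge_neg_of_det_eq_zero {n : ℕ} {s c : ℝ}
    {E A P : Matrix (Fin n) (Fin n) ℝ} (hE : (P * E).PosSemidef)
    (hA : ∀ z ≠ 0, sectorGauge s c (complexForm (P * A) z) < 0) {μ : ℂ}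
    (hμ : (μ • E.map Complex.ofReal - A.map Complex.ofReal).det = 0) : sectorGauge s c μ < 0 := by
  obtain ⟨z, hz, hker⟩ := Matrix.exists_mulVec_eq_zero_iff.2 hμ
  have hq : complexForm (P * A) z = (((complexForm (P * E) z).re : ℝ) : ℂ) * μ := by
    have him : (complexForm (P * E) z).im = 0 := by
      have := complexForm_im (P * E) (fun i => (z i).re) (fun i => (z i).im)
      simp only [Complex.eta] at this
      have hsymm : (P * E)ᵀ = P * E := by
        simpa [Matrix.conjTranspose_eq_transpose_of_trivial] using hE.isHermitian.eq
      rw [this, sub_eq_zero]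
      conv_rhs => rw [dotProduct_comm, ← hsymm, Matrix.mulVec_transpose, ← Matrix.dotProduct_mulVec]
    have hre : ((complexForm (P * E) z).re : ℂ) = complexForm (P * E) z :=
      Complex.ext (by simp) (by simp [him])
    have hAz : A.map Complex.ofReal *ᵥ z = μ • E.map Complex.ofReal *ᵥ z := by
      rw [Matrix.sub_mulVec, Matrix.smul_mulVec, sub_eq_zero] at hker
      exact hker.symm
    rw [hre, complexForm, complexForm, map_ofReal_mul, map_ofReal_mul, ← Matrix.mulVec_mulVec, hAz,
      Matrix.mulVec_smul, dotProduct_smul, Matrix.mulVec_mulVec, smul_eq_mul, mul_comm]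
  have hnonneg : 0 ≤ (complexForm (P * E) z).re := by
    have := complexForm_re (P * E) (fun i => (z i).re) (fun i => (z i).im)
    simp only [Complex.eta] at this
    rw [this]
    have h1 := hE.dotProduct_mulVec_nonneg (fun i => (z i).re)
    have h2 := hE.dotProduct_mulVec_nonneg (fun i => (z i).im)
    rw [star_trivial] at h1 h2
    exact add_nonneg h1 h2
  have := hA z hz
  rw [hq, sectorGauge_ofReal_mul s c hnonneg] at this
  by_contra! hc
  exact absurd (mul_nonneg hnonneg hc) (not_le.2 this)

theorem exists_multiplier_of_regularImpulseFree {n : ℕ} {s c : ℝ} (hs : 0 < s)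
    {E A : Matrix (Fin n) (Fin n) ℝ} (hEA : RegularImpulseFree E A)
    (hspec : ∀ μ : ℂ, (μ • E.map Complex.ofReal - A.map Complex.ofReal).det = 0 →
      sectorGauge s c μ < 0) :
    ∃ P : Matrix (Fin n) (Fin n) ℝ, (P * E).PosSemidef ∧
      ∀ z ≠ 0, sectorGauge s c (complexForm (P * A) z) < 0 := by
  obtain ⟨r, q, h, M, N, A₁, hM, hN, hE, hA⟩ := hEA
  obtain ⟨P₁, hP₁, hneg⟩ := exists_posDef_sectorGauge_neg s c A₁ fun μ hμ =>
    hspec μ (det_smul_sub_eq_zero_of_block h hM hN hE hA hμ)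
  set e := blockEquiv h with he
  set D : Matrix (Fin r ⊕ Fin q) (Fin r ⊕ Fin q) ℝ := Matrix.fromBlocks P₁ 0 0 (-1) with hD
  have hfactor : ∀ X : Matrix (Fin n) (Fin n) ℝ,
      (N⁻¹)ᵀ * D.submatrix e.symm e.symm * M * X
        = (N⁻¹)ᵀ * (D * (M * X * N).submatrix e e).submatrix e.symm e.symm * N⁻¹ := by
    intro X
    have hNN : N * N⁻¹ = 1 := Matrix.mul_nonsing_inv _ ((Matrix.isUnit_iff_isUnit_det _).1 hN)
    have : (D * (M * X * N).submatrix e e).submatrix e.symm e.symm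
        = D.submatrix e.symm e.symm * (M * X * N) := by
      rw [Matrix.submatrix_mul _ _ e.symm e.symm e.symm e.symm.bijective]
      simp
    rw [this]
    calc _ = (N⁻¹)ᵀ * D.submatrix e.symm e.symm * M * X * (N * N⁻¹) := by
          rw [hNN, Matrix.mul_one]
      _ = _ := by simp only [Matrix.mul_assoc]
  refine ⟨(N⁻¹)ᵀ * D.submatrix e.symm e.symm * M, ?_, ?_⟩
  · rw [hfactor, hE, hD, Matrix.fromBlocks_multiply]
    have := ((posSemidef_fromBlocks_zero (m := Fin q) hP₁.posSemidef).submatrix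
      e.symm).conjTranspose_mul_mul_same N⁻¹
    simpa [Matrix.conjTranspose_eq_transpose_of_trivial] using this
  · rw [hfactor, hA, hD, Matrix.fromBlocks_multiply]
    refine sectorGauge_complexForm_congruence (fun z hz => ?_)
      (injective_map_ofReal_mulVec (Matrix.isUnit_nonsing_inv_iff.2 hN))
    rw [complexForm_submatrix_symm]
    have := sectorGauge_complexForm_fromBlocks hneg
      (sectorGauge_complexForm_neg_one (m := Fin q) c hs) (z ∘ e) fun h0 => hz (by
        ext i
        simpa using congrFun h0 (e.symm i))
    simpa using this

/-- `(E, A, α)` with `1 < α < 2` is admissible iff there exists `P` with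
`Sym{Θ⊗(PA)} < 0` and `PE = EᵀPᵀ ≥ 0`. -/
theorem stmt_9 {n : ℕ} (α : ℝ) (hα₁ : 1 < α) (hα₂ : α < 2)
    (E A : Matrix (Fin n) (Fin n) ℝ) :
    Admissible E A α ↔
    ∃ P : Matrix (Fin n) (Fin n) ℝ,
      NegDef (matSym (Θmat α ⊗ₖ (P * A))) ∧
      P * E = Eᵀ * Pᵀ ∧ (P * E).PosSemidef := by
  have hpi := Real.pi_pos
  have hsector := lt_abs_arg_iff (θ := α * Real.pi / 2) (by nlinarith) (by nlinarith)
  have hs : 0 < Real.sin (α * Real.pi / 2) :=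
    Real.sin_pos_of_pos_of_lt_pi (by nlinarith) (by nlinarith)
  have hneg := fun P : Matrix (Fin n) (Fin n) ℝ => negDef_matSym_rotation_kronecker_iff
    (Real.sin (α * Real.pi / 2)) (Real.cos (α * Real.pi / 2)) (P * A)
  constructor
  · rintro ⟨hEA, hspec⟩
    obtain ⟨P, hPE, hPA⟩ := exists_multiplier_of_regularImpulseFree hs hEA
      fun μ hμ => (hsector μ).1 (hspec μ hμ)
    refine ⟨P, (hneg P).2 hPA, ?_, hPE⟩
    rw [← Matrix.transpose_mul, ← Matrix.conjTranspose_eq_transpose_of_trivial]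
    exact hPE.isHermitian.eq.symm
  · rintro ⟨P, hPA, -, hPE⟩
    exact ⟨regularImpulseFree_of_sectorGauge_neg hPE ((hneg P).1 hPA), fun μ hμ =>
      (hsector μ).2 (sectorGauge_neg_of_det_eq_zero hPE ((hneg P).1 hPA) hμ)⟩
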